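/- Let M, α, β > 0 and let (A^{(n)})_{n≥3} be a sequence of n×n real matrices such that each row of A^{(n)} has Euclidean norm √n, every entry satisfies |A^{(n)}_{ij}| ≤ M, and the covariance matrices Σ^{(n)} = (1/n)·A^{(n)}·(A^{(n)})ᵀ satisfy, for all distinct indices j, k, ℓ: det(Σ^{(n)}_{j,k}) > α² and det(Σ^{(n)}_{j,k,ℓ})/det(Σ^{(n)}_{j,k}) > β², where Σ_{j,k} and Σ_{j,k,ℓ} denote the principal 2×2 and 3×3 submatrices on the indicated rows and columns. Then, with Â^{(n)} = A^{(n)}/√n, one has limsup_{n→∞} √(log n) · ( β(Â^{(n)}) − [ √(2·log(2n)) − (log(log(2n)) + log(4π) − 2γ)/(2·√(2·log(2n))) ] ) ≤ 0, where γ is the Euler–Mascheroni constant. -/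

import Mathlib

open Finset

noncomputable section
open scoped Classical

/-- The sign `±1` associated to a Boolean. -/
def sgn (b : Bool) : ℝ := if b then 1 else -1

/-- The hypercube `{-1,1}^n` as a finite set of vectors in `ℝ^n`. -/
def cube (n : ℕ) : Finset (Fin n → ℝ) :=
  (Finset.univ : Finset (Fin n → Bool)).image (fun ε i => sgn (ε i))

/-- `β(A) = 2^{-n} ∑_{x ∈ {-1,1}^n} ‖Ax‖_∞` (the `Pi` norm on `Fin n → ℝ` is the sup norm). -/
def badBeta {n : ℕ} (A : Matrix (Fin n) (Fin n) ℝ) : ℝ :=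
  (2 ^ n : ℝ)⁻¹ * ∑ x ∈ cube n, ‖A.mulVec x‖

/-- The cell `S_i(A) = {x ∈ {-1,1}^n : ‖Ax‖_∞ = ⟨a_i, x⟩}`. -/
def cellS {n : ℕ} (A : Matrix (Fin n) (Fin n) ℝ) (i : Fin n) : Finset (Fin n → ℝ) :=
  (cube n).filter (fun x => ‖A.mulVec x‖ = ∑ j, A i j * x j)

/-- `A` is tie-free: no two distinct rows attain the same absolute inner product with a
hypercube vertex. -/
def TieFree {n : ℕ} (A : Matrix (Fin n) (Fin n) ℝ) : Prop :=
  ∀ x ∈ cube n, ∀ i j : Fin n, i ≠ j →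
    (∑ k, A i k * x k) ^ 2 ≠ (∑ k, A j k * x k) ^ 2

/-- Level-1 Fourier weight of `f : {-1,1}^n → ℝ`. -/
def W1 {n : ℕ} (f : (Fin n → ℝ) → ℝ) : ℝ :=
  ∑ i : Fin n, ((2 ^ n : ℝ)⁻¹ * ∑ x ∈ cube n, f x * x i) ^ 2

open MeasureTheory Pointwise in
lemma pl_compact (l : ℝ) (hl0 : 0 < l) (hl1 : l < 1) (A B C : Set ℝ)
    (hA : IsCompact A) (hB : IsCompact B) (hAn : A.Nonempty) (hBn : B.Nonempty)
    (h : ∀ x ∈ A, ∀ y ∈ B, (1 - l) * x + l * y ∈ C) :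
    ENNReal.ofReal (1 - l) * volume A + ENNReal.ofReal l * volume B ≤ volume C := by
  have h1 : 0 < 1 - l := by linarith
  obtain ⟨p, hpA, hp⟩ := hA.exists_isGreatest hAn
  obtain ⟨q, hqB, hq⟩ := hB.exists_isLeast hBn
  set K : Set ℝ := (fun x => (1 - l) * x + l * q) '' A with hK
  set L : Set ℝ := (fun y => (1 - l) * p + l * y) '' B with hL
  have hKm : MeasurableSet K := (hA.image (by fun_prop)).measurableSet
  have hLm : MeasurableSet L := (hB.image (by fun_prop)).measurableSet
  have hKv : volume K = ENNReal.ofReal (1 - l) * volume A := by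
    have : K = (fun x => x + l * q) '' ((1 - l) • A) := by
      rw [hK, ← Set.image_smul, Set.image_image]; rfl
    rw [this, Set.image_add_right, measure_preimage_add_right, Measure.addHaar_smul]
    simp [abs_of_pos h1]
  have hLv : volume L = ENNReal.ofReal l * volume B := by
    have : L = (fun x => (1 - l) * p + x) '' (l • B) := by
      rw [hL, ← Set.image_smul, Set.image_image]; rfl
    rw [this, Set.image_add_left, measure_preimage_add, Measure.addHaar_smul]
    simp [abs_of_pos hl0]
  have hint : AEDisjoint volume K L := by
    refine measure_mono_null (t := {(1 - l) * p + l * q}) ?_ (by simp)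
    rintro z ⟨⟨x, hx, rfl⟩, ⟨y, hy, hxy⟩⟩
    have hx' := hp hx
    have hy' := hq hy
    simp only at hxy
    simp only [Set.mem_singleton_iff]
    nlinarith
  rw [← hKv, ← hLv, ← measure_union₀ hLm.nullMeasurableSet hint]
  apply measure_mono
  rintro z (⟨x, hx, rfl⟩ | ⟨y, hy, rfl⟩)
  · exact h x hx q hqB
  · exact h p hpA y hy

open MeasureTheory in
lemma pl_sets (l : ℝ) (hl0 : 0 < l) (hl1 : l < 1) (A B C : Set ℝ)
    (hA : MeasurableSet A) (hB : MeasurableSet B) (hAn : A.Nonempty) (hBn : B.Nonempty)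
    (h : ∀ x ∈ A, ∀ y ∈ B, (1 - l) * x + l * y ∈ C) :
    ENNReal.ofReal (1 - l) * volume A + ENNReal.ofReal l * volume B ≤ volume C := by
  obtain ⟨x0, hx0⟩ := hAn
  obtain ⟨y0, hy0⟩ := hBn
  rw [hA.measure_eq_iSup_isCompact, hB.measure_eq_iSup_isCompact]
  simp only [ENNReal.mul_iSup]
  refine ENNReal.biSup_add_biSup_le' (p := fun K => K ⊆ A ∧ IsCompact K) (q := fun K => K ⊆ B ∧ IsCompact K) (f := fun K => ENNReal.ofReal (1 - l) * volume K) (g := fun K => ENNReal.ofReal l * volume K) ⟨∅, by simp⟩ ⟨∅, by simp⟩ ?_ |> (fun h => by simpa [iSup_and] using h)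
  rintro K ⟨hKA, hK⟩ L ⟨hLB, hL⟩
  refine le_trans ?_ (pl_compact l hl0 hl1 (insert x0 K) (insert y0 L) C (hK.insert _) (hL.insert _)
    (by simp) (by simp) ?_)
  · gcongr <;> simp
  · intro x hx y hy
    apply h
    · rcases hx with rfl | hx
      exacts [hx0, hKA hx]
    · rcases hy with rfl | hy
      exacts [hy0, hLB hy]

lemma ennreal_amgm (l : ℝ) (hl0 : 0 < l) (hl1 : l < 1) (X Y : ENNReal) :
    X ^ (1 - l) * Y ^ l ≤ ENNReal.ofReal (1 - l) * X + ENNReal.ofReal l * Y := by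
  have h1 : 0 < 1 - l := by linarith
  by_cases hX : X = ⊤
  · subst hX; rw [ENNReal.mul_top (a := ENNReal.ofReal (1 - l)) (by simpa using h1)]; simp
  by_cases hY : Y = ⊤
  · subst hY; rw [ENNReal.mul_top (a := ENNReal.ofReal l) (by simpa using hl0)]; simp
  lift X to NNReal using hX
  lift Y to NNReal using hY
  have := NNReal.geom_mean_le_arith_mean2_weighted (Real.toNNReal (1 - l)) (Real.toNNReal l) X Y
    (by rw [← Real.toNNReal_add h1.le hl0.le]; simp)
  rw [← ENNReal.coe_rpow_of_nonneg _ h1.le, ← ENNReal.coe_rpow_of_nonneg _ hl0.le]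
  simp only [Real.coe_toNNReal _ h1.le, Real.coe_toNNReal _ hl0.le] at this
  unfold ENNReal.ofReal
  exact_mod_cast this

open MeasureTheory in
lemma pl_core (l : ℝ) (hl0 : 0 < l) (hl1 : l < 1) (f g h : ℝ → ℝ)
    (hf : Measurable f) (hg : Measurable g) (hh : Measurable h)
    (hf0 : ∀ x, 0 ≤ f x) (hg0 : ∀ x, 0 ≤ g x) (hh0 : ∀ x, 0 ≤ h x)
    (hf1 : ∀ x, f x ≤ 1) (hg1 : ∀ x, g x ≤ 1)
    (hfs : ∀ s < 1, ∃ x, s < f x) (hgs : ∀ s < 1, ∃ x, s < g x)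
    (H : ∀ x y, f x ^ (1 - l) * g y ^ l ≤ h ((1 - l) * x + l * y)) :
    ENNReal.ofReal (1 - l) * (∫⁻ x, ENNReal.ofReal (f x))
      + ENNReal.ofReal l * (∫⁻ x, ENNReal.ofReal (g x)) ≤ ∫⁻ x, ENNReal.ofReal (h x) := by
  have h1 : 0 < 1 - l := by linarith
  rw [lintegral_eq_lintegral_meas_lt _ (.of_forall hf0) hf.aemeasurable,
    lintegral_eq_lintegral_meas_lt _ (.of_forall hg0) hg.aemeasurable,
    lintegral_eq_lintegral_meas_lt _ (.of_forall hh0) hh.aemeasurable]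
  have mf : Measurable (fun t => volume {a : ℝ | t < f a}) := by
    apply Antitone.measurable
    intro s t hst
    exact measure_mono (fun a ha => lt_of_le_of_lt hst ha)
  have mg : Measurable (fun t => volume {a : ℝ | t < g a}) := by
    apply Antitone.measurable
    intro s t hst
    exact measure_mono (fun a ha => lt_of_le_of_lt hst ha)
  rw [← lintegral_const_mul _ mf, ← lintegral_const_mul _ mg,
    ← lintegral_add_left (mf.const_mul _)]
  apply setLIntegral_mono' measurableSet_Ioi
  intro s hs
  have hs : 0 < s := hs
  by_cases hs1 : s < 1
  · apply pl_sets l hl0 hl1 _ _ _ (measurableSet_lt measurable_const hf)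
      (measurableSet_lt measurable_const hg) (hfs s hs1) (hgs s hs1)
    intro x hx y hy
    have hx : s < f x := hx
    have hy : s < g y := hy
    refine lt_of_lt_of_le ?_ (H x y)
    calc s = s ^ (1 - l) * s ^ l := by rw [← Real.rpow_add hs]; simp
      _ < f x ^ (1 - l) * g y ^ l := by
        apply mul_lt_mul'' (Real.rpow_lt_rpow hs.le hx h1) (Real.rpow_lt_rpow hs.le hy hl0) <;> positivity
  · have e1 : {a : ℝ | s < f a} = ∅ := by
      ext a; simp; linarith [hf1 a]
    have e2 : {a : ℝ | s < g a} = ∅ := by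
      ext a; simp; linarith [hg1 a]
    simp [e1, e2]

open MeasureTheory in
lemma pl_one (l : ℝ) (hl0 : 0 < l) (hl1 : l < 1) (f g h : ℝ → ℝ)
    (hf : Measurable f) (hg : Measurable g) (hh : Measurable h)
    (hf0 : ∀ x, 0 ≤ f x) (hg0 : ∀ x, 0 ≤ g x) (hh0 : ∀ x, 0 ≤ h x)
    (hf1 : ∀ x, f x ≤ 1) (hg1 : ∀ x, g x ≤ 1)
    (H : ∀ x y, f x ^ (1 - l) * g y ^ l ≤ h ((1 - l) * x + l * y)) :
    (∫⁻ x, ENNReal.ofReal (f x)) ^ (1 - l) * (∫⁻ x, ENNReal.ofReal (g x)) ^ l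
      ≤ ∫⁻ x, ENNReal.ofReal (h x) := by
  have h1 : 0 < 1 - l := by linarith
  by_cases hfz : ∀ x, f x = 0
  · simp [hfz, h1]
  by_cases hgz : ∀ x, g x = 0
  · simp [hgz, hl0]
  push Not at hfz hgz
  obtain ⟨x0, hx0⟩ := hfz
  obtain ⟨y0, hy0⟩ := hgz
  set S := sSup (Set.range f) with hS
  set T := sSup (Set.range g) with hT
  have bf : BddAbove (Set.range f) := ⟨1, by rintro _ ⟨x, rfl⟩; exact hf1 x⟩
  have bg : BddAbove (Set.range g) := ⟨1, by rintro _ ⟨x, rfl⟩; exact hg1 x⟩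
  have fS : ∀ x, f x ≤ S := fun x => le_csSup bf ⟨x, rfl⟩
  have gT : ∀ x, g x ≤ T := fun x => le_csSup bg ⟨x, rfl⟩
  have Spos : 0 < S := lt_of_lt_of_le (lt_of_le_of_ne (hf0 x0) (Ne.symm hx0)) (fS x0)
  have Tpos : 0 < T := lt_of_lt_of_le (lt_of_le_of_ne (hg0 y0) (Ne.symm hy0)) (gT y0)
  set R := S ^ (1 - l) * T ^ l with hR
  have Rpos : 0 < R := by positivity
  have core := pl_core l hl0 hl1 (fun x => f x / S) (fun x => g x / T) (fun x => h x / R)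
    (hf.div_const _) (hg.div_const _) (hh.div_const _)
    (fun x => div_nonneg (hf0 x) Spos.le) (fun x => div_nonneg (hg0 x) Tpos.le)
    (fun x => div_nonneg (hh0 x) Rpos.le)
    (fun x => (div_le_one Spos).2 (fS x)) (fun x => (div_le_one Tpos).2 (gT x))
    (by
      intro s hs
      obtain ⟨_, ⟨x, rfl⟩, hx⟩ := exists_lt_of_lt_csSup (Set.range_nonempty f)
        (show s * S < S by nlinarith)
      exact ⟨x, by rw [lt_div_iff₀ Spos]; exact hx⟩)
    (by
      intro s hs
      obtain ⟨_, ⟨x, rfl⟩, hx⟩ := exists_lt_of_lt_csSup (Set.range_nonempty g)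
        (show s * T < T by nlinarith)
      exact ⟨x, by rw [lt_div_iff₀ Tpos]; exact hx⟩)
    (by
      intro x y
      rw [Real.div_rpow (hf0 x) Spos.le, Real.div_rpow (hg0 y) Tpos.le, div_mul_div_comm]
      gcongr
      exact H x y)
  have e : ∀ (F : ℝ → ℝ) (c : ℝ), 0 < c → Measurable F → ∫⁻ x, ENNReal.ofReal (F x)
      = ENNReal.ofReal c * ∫⁻ x, ENNReal.ofReal (F x / c) := by
    intro F c hc hF
    rw [← lintegral_const_mul _ (by fun_prop)]
    congr 1; ext x
    rw [← ENNReal.ofReal_mul hc.le]; congr 1; field_simp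
  rw [e f S Spos hf, e g T Tpos hg, e h R Rpos hh, ENNReal.mul_rpow_of_nonneg _ _ h1.le,
    ENNReal.mul_rpow_of_nonneg _ _ hl0.le, ENNReal.ofReal_rpow_of_pos Spos,
    ENNReal.ofReal_rpow_of_pos Tpos, mul_mul_mul_comm, ← ENNReal.ofReal_mul (by positivity)]
  gcongr
  exact (ennreal_amgm l hl0 hl1 _ _).trans core

/-- Standard Gaussian product measure. -/
def gam (n : ℕ) : MeasureTheory.Measure (Fin n → ℝ) :=
  MeasureTheory.Measure.pi (fun _ => ProbabilityTheory.gaussianReal 0 1)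

instance gam_prob (n : ℕ) : MeasureTheory.IsProbabilityMeasure (gam n) := by
  unfold gam; infer_instance

open MeasureTheory ProbabilityTheory in
lemma gam_mp (n : ℕ) : MeasurePreserving (fun p : ℝ × (Fin n → ℝ) => (Fin.cons p.1 p.2 : Fin (n+1) → ℝ))
    ((gaussianReal 0 1).prod (gam n)) (gam (n+1)) := by
  have := (measurePreserving_piFinSuccAbove (fun _ : Fin (n+1) => gaussianReal 0 1) 0).symm
  unfold gam
  convert this using 1
  ext p i
  simp [MeasurableEquiv.piFinSuccAbove, Fin.insertNthEquiv]

open MeasureTheory ProbabilityTheory in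
lemma gam_lint (n : ℕ) (F : (Fin (n+1) → ℝ) → ENNReal) (hF : Measurable F) :
    ∫⁻ x, F x ∂(gam (n+1)) = ∫⁻ a, ∫⁻ y, F (Fin.cons a y) ∂(gam n) ∂(gaussianReal 0 1) := by
  rw [← (gam_mp n).lintegral_comp hF, lintegral_prod]
  exact (hF.comp (gam_mp n).measurable).aemeasurable

open MeasureTheory ProbabilityTheory in
lemma pl_gauss1 (l : ℝ) (hl0 : 0 < l) (hl1 : l < 1) (F G H : ℝ → ENNReal)
    (hF : Measurable F) (hG : Measurable G) (hH : Measurable H)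
    (hF1 : ∀ x, F x ≤ 1) (hG1 : ∀ x, G x ≤ 1) (hH1 : ∀ x, H x ≤ 1)
    (hyp : ∀ x y, F x ^ (1 - l) * G y ^ l ≤ H ((1 - l) * x + l * y)) :
    (∫⁻ x, F x ∂(gaussianReal 0 1)) ^ (1 - l) * (∫⁻ x, G x ∂(gaussianReal 0 1)) ^ l
      ≤ ∫⁻ x, H x ∂(gaussianReal 0 1) := by
  have h1 : 0 < 1 - l := by linarith
  have key : ∀ F : ℝ → ENNReal, Measurable F → (∀ x, F x ≤ 1) →
      ∫⁻ x, F x ∂(gaussianReal 0 1) =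
        ∫⁻ x, ENNReal.ofReal (gaussianPDFReal 0 1 x * (F x).toReal) := by
    intro F hF hF1
    rw [gaussianReal_of_var_ne_zero _ one_ne_zero,
      lintegral_withDensity_eq_lintegral_mul _ (measurable_gaussianPDF 0 1) hF]
    congr 1; ext x
    rw [ENNReal.ofReal_mul (gaussianPDFReal_nonneg _ _ _), ENNReal.ofReal_toReal
      ((hF1 x).trans_lt ENNReal.one_lt_top).ne]
    rfl
  have c1 : (Real.sqrt (2 * Real.pi))⁻¹ ≤ 1 := by
    apply inv_le_one_of_one_le₀
    rw [Real.one_le_sqrt]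
    nlinarith [Real.pi_gt_three]
  have hpdf : ∀ x, gaussianPDFReal 0 1 x = (Real.sqrt (2 * Real.pi))⁻¹ * Real.exp (-x^2/2) := by
    intro x; simp [gaussianPDFReal]
  have le1 : ∀ F : ℝ → ENNReal, (∀ x, F x ≤ 1) → ∀ x, gaussianPDFReal 0 1 x * (F x).toReal ≤ 1 := by
    intro F hF1 x
    have a1 : (F x).toReal ≤ 1 := ENNReal.toReal_le_of_le_ofReal zero_le_one (by simpa using hF1 x)
    have a2 : gaussianPDFReal 0 1 x ≤ 1 := by
      rw [hpdf]
      apply mul_le_one₀ c1 (Real.exp_pos _).le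
      rw [Real.exp_le_one_iff]; nlinarith [sq_nonneg x]
    exact mul_le_one₀ a2 ENNReal.toReal_nonneg a1
  have nn : ∀ F : ℝ → ENNReal, ∀ x, 0 ≤ gaussianPDFReal 0 1 x * (F x).toReal := fun F x =>
    mul_nonneg (gaussianPDFReal_nonneg _ _ _) ENNReal.toReal_nonneg
  have mm : ∀ F : ℝ → ENNReal, Measurable F → Measurable fun x => gaussianPDFReal 0 1 x * (F x).toReal :=
    fun F hF => (measurable_gaussianPDFReal 0 1).mul hF.ennreal_toReal
  rw [key F hF hF1, key G hG hG1, key H hH hH1]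
  apply pl_one l hl0 hl1 _ _ _ (mm F hF) (mm G hG) (mm H hH) (nn F) (nn G) (nn H) (le1 F hF1) (le1 G hG1)
  intro x y
  rw [Real.mul_rpow (gaussianPDFReal_nonneg _ _ _) ENNReal.toReal_nonneg,
    Real.mul_rpow (gaussianPDFReal_nonneg _ _ _) ENNReal.toReal_nonneg, mul_mul_mul_comm]
  apply mul_le_mul
  · rw [hpdf, hpdf, hpdf, Real.mul_rpow (by positivity) (by positivity),
      Real.mul_rpow (by positivity) (by positivity), mul_mul_mul_comm,
      ← Real.rpow_add (by positivity), ← Real.exp_mul, ← Real.exp_mul, ← Real.exp_add]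
    simp only [sub_add_cancel, Real.rpow_one]
    gcongr
    nlinarith [mul_nonneg (mul_nonneg hl0.le h1.le) (sq_nonneg (x - y))]
  · rw [ENNReal.toReal_rpow, ENNReal.toReal_rpow, ← ENNReal.toReal_mul]
    exact ENNReal.toReal_mono ((hH1 _).trans_lt ENNReal.one_lt_top).ne (hyp x y)
  · positivity
  · exact gaussianPDFReal_nonneg _ _ _

open MeasureTheory ProbabilityTheory in
lemma pl_gam (l : ℝ) (hl0 : 0 < l) (hl1 : l < 1) (n : ℕ) : ∀ (F G H : (Fin n → ℝ) → ENNReal)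
    (_ : Measurable F) (_ : Measurable G) (_ : Measurable H)
    (_ : ∀ x, F x ≤ 1) (_ : ∀ x, G x ≤ 1) (_ : ∀ x, H x ≤ 1)
    (_ : ∀ x y, F x ^ (1 - l) * G y ^ l ≤ H ((1 - l) • x + l • y)),
    (∫⁻ x, F x ∂(gam n)) ^ (1 - l) * (∫⁻ x, G x ∂(gam n)) ^ l
      ≤ ∫⁻ x, H x ∂(gam n) := by
  induction n with
  | zero =>
    intro F G H hF hG hH hF1 hG1 hH1 hyp
    have e : ∀ F : (Fin 0 → ℝ) → ENNReal, ∫⁻ x, F x ∂(gam 0) = F 0 := by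
      intro F
      have : F = fun _ => F 0 := by ext x; rw [Subsingleton.elim x 0]
      rw [this]; simp
    rw [e, e, e]
    simpa using hyp 0 0
  | succ n ih =>
    intro F G H hF hG hH hF1 hG1 hH1 hyp
    have mc : ∀ F : (Fin (n+1) → ℝ) → ENNReal, Measurable F →
        Measurable fun p : ℝ × (Fin n → ℝ) => F (Fin.cons p.1 p.2) :=
      fun F hF => hF.comp (gam_mp n).measurable
    have le1 : ∀ F : (Fin (n+1) → ℝ) → ENNReal, (∀ x, F x ≤ 1) → ∀ a,
        ∫⁻ y, F (Fin.cons a y) ∂(gam n) ≤ 1 := by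
      intro F hF a
      calc _ ≤ ∫⁻ y, 1 ∂(gam n) := lintegral_mono fun y => hF _
        _ = 1 := by simp
    rw [gam_lint n F hF, gam_lint n G hG, gam_lint n H hH]
    apply pl_gauss1 l hl0 hl1 _ _ _ (mc F hF).lintegral_prod_right' (mc G hG).lintegral_prod_right'
      (mc H hH).lintegral_prod_right' (le1 F hF1) (le1 G hG1) (le1 H hH1)
    intro a b
    apply ih _ _ _ ((mc F hF).comp measurable_prodMk_left) ((mc G hG).comp measurable_prodMk_left)
      ((mc H hH).comp measurable_prodMk_left) (fun _ => hF1 _) (fun _ => hG1 _) (fun _ => hH1 _)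
    intro x y
    refine (hyp _ _).trans_eq ?_
    congr 1
    ext i
    refine Fin.cases ?_ (fun j => ?_) i <;> simp

open MeasureTheory ProbabilityTheory in
lemma cfd_gauss (L : StrongDual ℝ ℝ) :
    charFunDual (gaussianReal 0 1) L = Complex.exp (-((L 1 : ℝ) : ℂ)^2 / 2) := by
  have h := charFun_gaussianReal (μ := 0) (v := 1) (L 1)
  rw [charFun_apply_real] at h
  rw [charFunDual_apply]
  have e : ∀ v : ℝ, L v = L 1 * v := by
    intro v
    have := L.map_smul v 1
    simp only [smul_eq_mul, mul_one] at this
    rw [this]; ring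
  rw [show (fun v : ℝ => Complex.exp ((L v : ℂ) * Complex.I))
    = fun v : ℝ => Complex.exp (((L 1 : ℝ) : ℂ) * (v : ℂ) * Complex.I) from by
      ext v; rw [e v]; push_cast; rfl]
  rw [h]
  congr 1
  simp; ring

open MeasureTheory ProbabilityTheory in
lemma cfd_gam (n : ℕ) (L : StrongDual ℝ (Fin n → ℝ)) :
    charFunDual (gam n) L = Complex.exp (-((∑ i, (L (Pi.single i 1))^2 : ℝ) : ℂ) / 2) := by
  unfold gam
  rw [charFunDual_pi]
  simp_rw [cfd_gauss]
  rw [← Complex.exp_sum]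
  congr 1
  push_cast
  rw [← Finset.sum_neg_distrib, Finset.sum_div]
  congr 1

open MeasureTheory ProbabilityTheory in
lemma gam_neg (n : ℕ) : MeasurePreserving (fun x : Fin n → ℝ => -x) (gam n) (gam n) := by
  refine ⟨by fun_prop, ?_⟩
  have : IsProbabilityMeasure ((gam n).map (fun x : Fin n → ℝ => -x)) :=
    Measure.isProbabilityMeasure_map (by fun_prop)
  apply Measure.ext_of_charFunDual
  ext L
  have := charFunDual_map (μ := gam n) (-ContinuousLinearMap.id ℝ (Fin n → ℝ)) L
  have e : (⇑(-ContinuousLinearMap.id ℝ (Fin n → ℝ))) = (fun x : Fin n → ℝ => -x) := by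
    ext x; simp
  rw [e] at this
  rw [this, cfd_gam, cfd_gam]
  simp

/-- Decomposition of a vector along `u`. -/
def TT {n : ℕ} (u : Fin n → ℝ) (p : ℝ × (Fin n → ℝ)) : Fin n → ℝ :=
  p.1 • u + (p.2 - (∑ i, u i * p.2 i) • u)

open MeasureTheory ProbabilityTheory in
lemma TT_mp {n : ℕ} (u : Fin n → ℝ) (hu : ∑ i, u i ^ 2 = 1) :
    MeasurePreserving (TT u) ((gaussianReal 0 1).prod (gam n)) (gam n) := by
  have hc : Continuous (TT u) := by unfold TT; fun_prop
  refine ⟨hc.measurable, ?_⟩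
  have : IsProbabilityMeasure (((gaussianReal 0 1).prod (gam n)).map (TT u)) :=
    Measure.isProbabilityMeasure_map hc.measurable.aemeasurable
  apply Measure.ext_of_charFunDual
  ext L
  let Tl : (ℝ × (Fin n → ℝ)) →ₗ[ℝ] (Fin n → ℝ) :=
    { toFun := TT u
      map_add' := by
        intro p q
        ext i
        simp [TT, mul_add, Finset.sum_add_distrib]; ring
      map_smul' := by
        intro c p
        have : ∑ i, u i * (c * p.2 i) = c * ∑ i, u i * p.2 i := by
          rw [Finset.mul_sum]; congr 1; ext i; ring
        ext i
        simp [TT, this]; ring }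
  let Tc : (ℝ × (Fin n → ℝ)) →L[ℝ] (Fin n → ℝ) := ⟨Tl, hc⟩
  have h := charFunDual_map (μ := (gaussianReal 0 1).prod (gam n)) Tc L
  have e : ⇑Tc = TT u := rfl
  rw [e] at h
  rw [h, charFunDual_prod, cfd_gauss, cfd_gam, cfd_gam, ← Complex.exp_add]
  congr 1
  have a1 : ((L.comp Tc).comp (ContinuousLinearMap.inl ℝ ℝ (Fin n → ℝ))) 1 = L u := by
    have : TT u (1, 0) = u := by ext i; simp [TT]
    simp [e, this]
  have a2 : ∀ i, ((L.comp Tc).comp (ContinuousLinearMap.inr ℝ ℝ (Fin n → ℝ))) (Pi.single i 1)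
      = L (Pi.single i 1) - u i * L u := by
    intro i
    have : TT u (0, Pi.single i 1) = Pi.single i 1 - (u i) • u := by
      ext j; simp [TT, Pi.single_apply]
    simp [e, this]
  have a3 : L u = ∑ i, u i * L (Pi.single i 1) := by
    conv_lhs => rw [← Finset.univ_sum_single u]
    rw [map_sum]
    congr 1; ext i
    have : (Pi.single i (u i) : Fin n → ℝ) = u i • Pi.single i 1 := by
      rw [← Pi.single_smul]; simp
    rw [this, map_smul]; rfl
  rw [a1]
  simp_rw [a2]
  have a4 : (L u)^2 + ∑ i, (L (Pi.single i 1) - u i * L u)^2 = ∑ i, (L (Pi.single i 1))^2 := by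
    have : ∀ i, (L (Pi.single i 1) - u i * L u)^2
      = (L (Pi.single i 1))^2 - 2 * L u * (u i * L (Pi.single i 1)) + (L u)^2 * (u i)^2 := by
      intro i; ring
    simp_rw [this]
    rw [Finset.sum_add_distrib, Finset.sum_sub_distrib, ← Finset.mul_sum, ← Finset.mul_sum, ← a3, hu]
    ring
  rw [← a4]
  push_cast
  ring

open MeasureTheory ProbabilityTheory in
lemma anderson {n : ℕ} (u : Fin n → ℝ) (K : Set (Fin n → ℝ)) (hK : MeasurableSet K)
    (hconv : Convex ℝ K) (hsym : ∀ x ∈ K, -x ∈ K) (x z : ℝ) (hxz : |x| ≤ |z|) :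
    gam n {y | TT u (z, y) ∈ K} ≤ gam n {y | TT u (x, y) ∈ K} := by
  have hc : Continuous (TT u) := by unfold TT; fun_prop
  have ms : ∀ s : ℝ, MeasurableSet {y | TT u (s, y) ∈ K} := fun s =>
    (hc.measurable.comp measurable_prodMk_left) hK
  have hneg : ∀ s : ℝ, gam n {y | TT u (-s, y) ∈ K} = gam n {y | TT u (s, y) ∈ K} := by
    intro s
    rw [← (gam_neg n).measure_preimage (ms s).nullMeasurableSet]
    congr 1
    ext y
    have : TT u (-s, y) = - TT u (s, -y) := by
      ext i; simp [TT]; ring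
    simp only [Set.mem_ofPred_eq, Set.mem_preimage, this]
    constructor
    · intro h; simpa using hsym _ h
    · intro h; exact hsym _ h
  rcases hxz.eq_or_lt with h | h
  · rcases abs_eq_abs.1 h with h | h
    · rw [h]
    · rw [h, hneg]
  have hz : z ≠ 0 := by rintro rfl; simp at h; linarith [abs_nonneg x]
  have hr : |x / z| < 1 := by rw [abs_div, div_lt_one (by positivity)]; exact h
  have hr' := abs_lt.1 hr
  set l := (1 - x / z) / 2 with hl
  have hl0 : 0 < l := by rw [hl]; linarith
  have hl1 : l < 1 := by rw [hl]; linarith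
  have hxl : (1 - l) * z + l * (-z) = x := by rw [hl]; field_simp; ring
  have h1 : 0 < 1 - l := by linarith
  have mi : ∀ s : ℝ, Measurable ({y | TT u (s, y) ∈ K}.indicator (1 : (Fin n → ℝ) → ENNReal)) :=
    fun s => measurable_one.indicator (ms s)
  have le1 : ∀ s : ℝ, ∀ y, ({y | TT u (s, y) ∈ K}.indicator (1 : (Fin n → ℝ) → ENNReal)) y ≤ 1 :=
    fun s y => Set.indicator_le_self' (by simp) y
  have := pl_gam l hl0 hl1 n _ _ _ (mi z) (mi (-z)) (mi x) (le1 z) (le1 (-z)) (le1 x) ?_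
  · rw [lintegral_indicator_one (ms _), lintegral_indicator_one (ms _),
      lintegral_indicator_one (ms _), hneg, ← ENNReal.rpow_add_of_nonneg _ _ h1.le hl0.le] at this
    simpa using this
  intro y w
  by_cases hy : TT u (z, y) ∈ K
  · by_cases hw : TT u (-z, w) ∈ K
    · have hm : TT u (x, (1 - l) • y + l • w) ∈ K := by
        have : TT u (x, (1 - l) • y + l • w) = (1 - l) • TT u (z, y) + l • TT u (-z, w) := by
          have e : ∑ i, u i * ((1 - l) * y i + l * w i)
            = (1 - l) * ∑ i, u i * y i + l * ∑ i, u i * w i := by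
            rw [Finset.mul_sum, Finset.mul_sum, ← Finset.sum_add_distrib]
            congr 1; ext i; ring
          ext i
          simp only [TT, Pi.add_apply, Pi.smul_apply, Pi.sub_apply, smul_eq_mul, e]
          rw [← hxl]; ring
        rw [this]
        exact hconv hy hw h1.le hl0.le (by ring)
      simp [Set.indicator, hm, hy, hw]
    · simp [Set.indicator, hw, hl0]
  · simp [Set.indicator, hy, h1]

open MeasureTheory ProbabilityTheory in
lemma sidak_step {n : ℕ} (u : Fin n → ℝ) (hu : ∑ i, u i ^ 2 = 1)
    (K : Set (Fin n → ℝ)) (hK : MeasurableSet K)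
    (hconv : Convex ℝ K) (hsym : ∀ x ∈ K, -x ∈ K) (t : ℝ) (ht : 0 ≤ t) :
    gam n K * gaussianReal 0 1 (Set.Icc (-t) t) ≤ gam n (K ∩ {y | |∑ i, u i * y i| ≤ t}) := by
  have hc : Continuous (TT u) := by unfold TT; fun_prop
  have hS : MeasurableSet {y : Fin n → ℝ | |∑ i, u i * y i| ≤ t} :=
    (isClosed_le (by fun_prop) (by fun_prop)).measurableSet
  have hI : MeasurableSet (Set.Icc (-t) t) := measurableSet_Icc
  set h : ℝ → ENNReal := fun x => gam n {y | TT u (x, y) ∈ K} with hh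
  have hm : Measurable h := measurable_measure_prodMk_left (hc.measurable hK)
  have e1 : gam n K = ∫⁻ x in Set.Icc (-t) t, h x ∂(gaussianReal 0 1)
      + ∫⁻ x in (Set.Icc (-t) t)ᶜ, h x ∂(gaussianReal 0 1) := by
    rw [lintegral_add_compl _ hI, ← (TT_mp u hu).measure_preimage hK.nullMeasurableSet,
      Measure.prod_apply (hc.measurable hK)]
    rfl
  have uT : ∀ x y, ∑ i, u i * TT u (x, y) i = x := by
    intro x y
    have : ∀ i, u i * TT u (x, y) i = x * u i ^ 2 + u i * y i - (∑ j, u j * y j) * u i ^ 2 := by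
      intro i; simp [TT]; ring
    simp_rw [this]
    rw [Finset.sum_sub_distrib, Finset.sum_add_distrib, ← Finset.mul_sum, ← Finset.mul_sum, hu]
    ring
  have e2 : gam n (K ∩ {y | |∑ i, u i * y i| ≤ t})
      = ∫⁻ x in Set.Icc (-t) t, h x ∂(gaussianReal 0 1) := by
    rw [← (TT_mp u hu).measure_preimage (hK.inter hS).nullMeasurableSet,
      Measure.prod_apply (hc.measurable (hK.inter hS)), ← lintegral_indicator hI]
    congr 1; ext x
    by_cases hx : x ∈ Set.Icc (-t) t
    · rw [Set.indicator_of_mem hx]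
      simp only [hh]
      congr 1; ext y
      simp [uT, abs_le.2 hx]
    · rw [Set.indicator_of_notMem hx]
      have : ¬ |x| ≤ t := fun h => hx (abs_le.1 h)
      convert measure_empty (μ := gam n)
      ext y
      simp [uT, this]
  have b1 : h t * gaussianReal 0 1 (Set.Icc (-t) t) ≤ ∫⁻ x in Set.Icc (-t) t, h x ∂(gaussianReal 0 1) := by
    rw [← setLIntegral_const]
    apply setLIntegral_mono' hI
    intro x hx
    exact anderson u K hK hconv hsym x t ((abs_le.2 hx).trans (le_abs_self t))
  have b2 : ∫⁻ x in (Set.Icc (-t) t)ᶜ, h x ∂(gaussianReal 0 1) ≤ h t * gaussianReal 0 1 (Set.Icc (-t) t)ᶜ := by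
    rw [← setLIntegral_const]
    apply setLIntegral_mono' hI.compl
    intro x hx
    apply anderson u K hK hconv hsym t x
    rw [abs_of_nonneg ht]
    by_contra hcon
    exact hx (abs_le.1 (not_le.1 hcon).le)
  have pq : gaussianReal 0 1 (Set.Icc (-t) t) + gaussianReal 0 1 (Set.Icc (-t) t)ᶜ = 1 := by
    rw [measure_add_measure_compl hI]; simp
  rw [e1, e2]
  set I := ∫⁻ x in Set.Icc (-t) t, h x ∂(gaussianReal 0 1)
  set O := ∫⁻ x in (Set.Icc (-t) t)ᶜ, h x ∂(gaussianReal 0 1)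
  set p := gaussianReal 0 1 (Set.Icc (-t) t)
  set q := gaussianReal 0 1 (Set.Icc (-t) t)ᶜ
  calc (I + O) * p = I * p + O * p := by ring
    _ ≤ I * p + (h t * q) * p := by gcongr
    _ = I * p + (h t * p) * q := by ring
    _ ≤ I * p + I * q := by gcongr
    _ = I := by rw [← mul_add, pq, mul_one]

open MeasureTheory ProbabilityTheory in
lemma sidak {n : ℕ} (U : Fin n → Fin n → ℝ) (hU : ∀ k, ∑ i, U k i ^ 2 = 1) (t : ℝ) (ht : 0 ≤ t) :
    (gaussianReal 0 1 (Set.Icc (-t) t)) ^ n ≤ gam n {y | ∀ k, |∑ i, U k i * y i| ≤ t} := by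
  have key : ∀ s : Finset (Fin n), (gaussianReal 0 1 (Set.Icc (-t) t)) ^ s.card
      ≤ gam n {y | ∀ k ∈ s, |∑ i, U k i * y i| ≤ t} := by
    intro s
    induction s using Finset.induction_on with
    | empty => simp
    | insert a s ha ih =>
      rw [Finset.card_insert_of_notMem ha, pow_succ]
      have hK : IsClosed {y : Fin n → ℝ | ∀ k ∈ s, |∑ i, U k i * y i| ≤ t} := by
        have : {y : Fin n → ℝ | ∀ k ∈ s, |∑ i, U k i * y i| ≤ t}
          = ⋂ k ∈ s, {y : Fin n → ℝ | |∑ i, U k i * y i| ≤ t} := by ext; simp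
        rw [this]
        exact isClosed_biInter fun k _ => isClosed_le (by fun_prop) (by fun_prop)
      calc _ ≤ gam n {y | ∀ k ∈ s, |∑ i, U k i * y i| ≤ t} * gaussianReal 0 1 (Set.Icc (-t) t) := by
            gcongr
        _ ≤ _ := sidak_step (U a) (hU a) _ hK.measurableSet ?_ ?_ t ht
        _ = _ := by congr 1; ext y; simp [and_comm]
      · intro x hx y hy c d hc hd hcd k hk
        have e : ∑ i, U k i * (c • x + d • y) i = c * ∑ i, U k i * x i + d * ∑ i, U k i * y i := by
          rw [Finset.mul_sum, Finset.mul_sum, ← Finset.sum_add_distrib]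
          congr 1; ext i; simp; ring
        rw [e]
        have hx' := abs_le.1 (hx k hk)
        have hy' := abs_le.1 (hy k hk)
        have : d = 1 - c := by linarith
        subst this
        rw [abs_le]
        constructor <;> nlinarith
      · intro x hx k hk
        have := hx k hk
        simpa [Finset.sum_neg_distrib] using this
  simpa using key Finset.univ

open MeasureTheory ProbabilityTheory in
lemma gauss_tail_one (a t : ℝ) (ha : 0 < a) :
    (gaussianReal 0 1).real (Set.Ioi t) ≤
      (Real.sqrt (2 * Real.pi))⁻¹ * Real.exp (a^2/2) * (Real.exp (-(a * t)) / a) := by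
  have hI := integrableOn_exp_mul_Ioi (a := -a) (by linarith) t
  have hv := integral_exp_mul_Ioi (a := -a) (by linarith) t
  rw [measureReal_def, gaussianReal_apply_eq_integral _ one_ne_zero,
    ENNReal.toReal_ofReal (integral_nonneg fun x => gaussianPDFReal_nonneg _ _ _)]
  calc ∫ x in Set.Ioi t, gaussianPDFReal 0 1 x
      ≤ ∫ x in Set.Ioi t, (Real.sqrt (2 * Real.pi))⁻¹ * Real.exp (a^2/2) * Real.exp (-a * x) := by
        apply integral_mono (integrable_gaussianPDFReal 0 1).integrableOn (hI.const_mul _)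
        intro x
        simp only [gaussianPDFReal]
        rw [mul_assoc _ (Real.exp (a^2/2)), ← Real.exp_add]
        simp only [NNReal.coe_one, mul_one, sub_zero]
        gcongr
        nlinarith [sq_nonneg (x - a)]
    _ = _ := by
        rw [integral_const_mul, hv]
        congr 1
        rw [neg_div, div_neg, neg_neg, neg_mul]

open MeasureTheory ProbabilityTheory in
lemma gauss_tail (a t : ℝ) (ha : 0 < a) :
    1 - 2 * (Real.sqrt (2 * Real.pi))⁻¹ * Real.exp (a^2/2) * (Real.exp (-(a * t)) / a) ≤
    (gaussianReal 0 1).real (Set.Icc (-t) t) := by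
  have h1 := gauss_tail_one a t ha
  have h2 : (gaussianReal 0 1).real (Set.Iio (-t)) = (gaussianReal 0 1).real (Set.Ioi t) := by
    have : gaussianReal 0 1 = (gaussianReal 0 1).map (fun x => -x) := by
      rw [gaussianReal_map_neg]; simp
    rw [measureReal_def, measureReal_def]
    conv_rhs => rw [this]
    rw [Measure.map_apply (by fun_prop) measurableSet_Ioi]
    congr 2
    ext x; simp
  have h3 : (Set.Icc (-t) t)ᶜ ⊆ Set.Iio (-t) ∪ Set.Ioi t := by
    intro x hx
    by_contra h
    simp at h hx
    linarith [hx h.1]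
  have h4 := probReal_compl_eq_one_sub (μ := gaussianReal 0 1) (measurableSet_Icc (a := -t) (b := t))
  have h5 := (measureReal_mono (μ := gaussianReal 0 1) h3).trans (measureReal_union_le _ _)
  linarith

open MeasureTheory ProbabilityTheory Filter Topology in
lemma gumbel_int (n : ℕ) (a τ : ℝ) (ha : 0 < a) :
    IntegrableOn (fun t => 1 - (1 - Real.exp (-(a * (t - τ))))^n) (Set.Ioi τ) ∧
    ∫ t in Set.Ioi τ, (1 - (1 - Real.exp (-(a * (t - τ))))^n) = (harmonic n : ℝ) / a := by
  set P : ℝ → ℝ := fun t => (∑ k ∈ Finset.range n, (1 - Real.exp (-(a * (t - τ))))^(k+1) * ((k:ℝ)+1)⁻¹) / a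
  have hd : ∀ t ∈ Set.Ici τ, HasDerivAt P (1 - (1 - Real.exp (-(a * (t - τ))))^n) t := by
    intro t _
    have h0 : HasDerivAt (fun t => 1 - Real.exp (-(a * (t - τ)))) (a * Real.exp (-(a * (t - τ)))) t := by
      have : HasDerivAt (fun t => -(a * (t - τ))) (-(a * 1)) t :=
        (((hasDerivAt_id t).sub_const τ).const_mul a).neg
      have := this.exp.const_sub 1
      refine this.congr_deriv ?_
      ring
    have h1 : HasDerivAt P ((∑ k ∈ Finset.range n, (((k+1 : ℕ) : ℝ) * (1 - Real.exp (-(a * (t - τ))))^k *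
        (a * Real.exp (-(a * (t - τ))))) * ((k:ℝ)+1)⁻¹) / a) t := by
      apply HasDerivAt.div_const
      apply HasDerivAt.fun_sum
      intro k _
      apply HasDerivAt.mul_const
      simpa using h0.fun_pow (k+1)
    convert h1 using 1
    set x := Real.exp (-(a * (t - τ)))
    have h2 : ∀ k ∈ Finset.range n, (((k+1 : ℕ) : ℝ) * (1 - x)^k * (a * x)) * ((k:ℝ)+1)⁻¹ = (a * x) * (1 - x)^k := by
      intro k _
      have : (k:ℝ) + 1 ≠ 0 := by positivity
      push_cast; field_simp
    rw [Finset.sum_congr rfl h2, ← Finset.mul_sum]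
    have := mul_neg_geom_sum (1 - x) n
    rw [sub_sub_cancel] at this
    rw [mul_assoc, this]; field_simp
  have hpos : ∀ t ∈ Set.Ioi τ, 0 ≤ 1 - (1 - Real.exp (-(a * (t - τ))))^n := by
    intro t ht
    have ht : τ < t := ht
    have : Real.exp (-(a * (t - τ))) ≤ 1 := by
      rw [Real.exp_le_one_iff]; nlinarith
    have h3 := Real.exp_pos (-(a * (t - τ)))
    have := pow_le_one₀ (n := n) (by linarith : 0 ≤ 1 - Real.exp (-(a * (t - τ)))) (by linarith)
    linarith
  have hl : Tendsto P atTop (𝓝 ((harmonic n : ℝ) / a)) := by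
    have h0 : Tendsto (fun t => Real.exp (-(a * (t - τ)))) atTop (𝓝 0) := by
      apply Real.tendsto_exp_neg_atTop_nhds_zero.comp
      apply Tendsto.const_mul_atTop ha
      exact tendsto_atTop_add_const_right _ _ tendsto_id
    have : (harmonic n : ℝ) = ∑ k ∈ Finset.range n, (1 - 0 : ℝ)^(k+1) * ((k:ℝ)+1)⁻¹ := by
      simp [harmonic]
    rw [this]
    apply Tendsto.div_const
    apply tendsto_finsetSum
    intro k _
    apply Tendsto.mul_const
    exact (h0.const_sub 1).pow (k+1)
  refine ⟨integrableOn_Ioi_deriv_of_nonneg' hd hpos hl, ?_⟩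
  rw [integral_Ioi_of_hasDerivAt_of_nonneg' hd hpos hl]
  simp [P]

open MeasureTheory ProbabilityTheory in
lemma gam_abs_int (n : ℕ) (i : Fin n) : Integrable (fun y : Fin n → ℝ => |y i|) (gam n) := by
  have h : Integrable (fun x : ℝ => |x|) (gaussianReal 0 1) := by
    have := (memLp_id_gaussianReal (μ := 0) (v := 1) 1).integrable (by simp)
    exact this.abs
  exact (measurePreserving_eval (fun _ : Fin n => gaussianReal 0 1) i).integrable_comp_of_integrable h

open MeasureTheory ProbabilityTheory in
lemma emax {n : ℕ} (U : Matrix (Fin n) (Fin n) ℝ) (hU : ∀ k, ∑ i, U k i ^ 2 = 1)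
    (a τ : ℝ) (ha : 0 < a) (hτ : 0 ≤ τ)
    (hC : Real.exp (a * τ) = 2 * (Real.sqrt (2 * Real.pi))⁻¹ * Real.exp (a^2/2) / a) :
    Integrable (fun y => ‖U.mulVec y‖) (gam n) ∧
    ∫ y, ‖U.mulVec y‖ ∂(gam n) ≤ τ + (harmonic n : ℝ) / a := by
  have hcont : Continuous (fun y => ‖U.mulVec y‖) := by fun_prop
  have hint : Integrable (fun y => ‖U.mulVec y‖) (gam n) := by
    have hB : Integrable (fun y : Fin n → ℝ => ∑ k, ∑ i, |U k i| * |y i|) (gam n) :=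
      integrable_finsetSum _ fun k _ => integrable_finsetSum _ fun i _ =>
        (gam_abs_int n i).const_mul _
    apply hB.mono' hcont.aestronglyMeasurable
    refine .of_forall fun y => ?_
    rw [Real.norm_eq_abs, abs_of_nonneg (norm_nonneg _)]
    rw [pi_norm_le_iff_of_nonneg (by positivity)]
    intro k
    calc ‖(U.mulVec y) k‖ ≤ ∑ i, ‖U k i * y i‖ := norm_sum_le Finset.univ (fun i => U k i * y i)
      _ = ∑ i, |U k i| * |y i| := by simp
      _ ≤ ∑ k, ∑ i, |U k i| * |y i| :=
        Finset.single_le_sum (f := fun k => ∑ i, |U k i| * |y i|) (fun k _ => by positivity) (Finset.mem_univ k)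
  refine ⟨hint, ?_⟩
  rw [hint.integral_eq_integral_meas_lt (.of_forall fun y => norm_nonneg _)]
  obtain ⟨g1, g2⟩ := gumbel_int n a τ ha
  set g : ℝ → ℝ := fun t => 1 - (1 - Real.exp (-(a * (t - τ))))^n with hg
  have hsplit : Set.Ioi (0:ℝ) = Set.Ioc 0 τ ∪ Set.Ioi τ := (Set.Ioc_union_Ioi_eq_Ioi hτ).symm
  set B : ℝ → ℝ := fun t => if t ≤ τ then 1 else g t with hB
  have B1 : Set.EqOn B (fun _ => 1) (Set.Ioc 0 τ) := fun t ht => by simp [hB, ht.2]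
  have B2 : Set.EqOn B g (Set.Ioi τ) := fun t ht => by
    have : ¬ t ≤ τ := not_le.2 ht
    simp [hB, this]
  have iB1 : IntegrableOn B (Set.Ioc 0 τ) := by
    rw [integrableOn_congr_fun B1 measurableSet_Ioc]
    exact integrableOn_const (by simp)
  have iB2 : IntegrableOn B (Set.Ioi τ) := by
    rw [integrableOn_congr_fun B2 measurableSet_Ioi]; exact g1
  have vB : ∫ t in Set.Ioi 0, B t = τ + (harmonic n : ℝ) / a := by
    rw [hsplit, setIntegral_union (Set.Ioc_disjoint_Ioi le_rfl) measurableSet_Ioi iB1 iB2,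
      setIntegral_congr_fun measurableSet_Ioc B1, setIntegral_congr_fun measurableSet_Ioi B2, g2]
    simp [hτ]
  rw [← vB]
  apply integral_mono_of_nonneg (.of_forall fun t => measureReal_nonneg)
  · rw [hsplit]; exact iB1.union iB2
  · filter_upwards [ae_restrict_mem measurableSet_Ioi] with t ht
    have ht : 0 < t := ht
    by_cases h : t ≤ τ
    · simp only [hB, h, if_true]
      exact measureReal_le_one
    · simp only [hB, h, if_false, hg]
      push Not at h
      have s1 := sidak (fun k i => U k i) hU t ht.le
      have hset : {y : Fin n → ℝ | t < ‖U.mulVec y‖} = {y | ∀ k, |∑ i, U k i * y i| ≤ t}ᶜ := by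
        ext y
        rw [Set.mem_compl_iff, Set.mem_ofPred_eq, Set.mem_ofPred_eq, ← not_le,
          pi_norm_le_iff_of_nonneg ht.le]
        rfl
      have hms : MeasurableSet {y : Fin n → ℝ | ∀ k, |∑ i, U k i * y i| ≤ t} := by
        rw [← MeasurableSet.compl_iff, ← hset]
        exact measurableSet_lt measurable_const hcont.measurable
      rw [hset, probReal_compl_eq_one_sub hms]
      have s2 : ((gaussianReal 0 1).real (Set.Icc (-t) t))^n ≤
          (gam n).real {y | ∀ k, |∑ i, U k i * y i| ≤ t} := by
        rw [measureReal_def, measureReal_def, ← ENNReal.toReal_pow]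
        exact ENNReal.toReal_mono (measure_ne_top _ _) s1
      have s3 := gauss_tail a t ha
      have s4 : 2 * (Real.sqrt (2 * Real.pi))⁻¹ * Real.exp (a^2/2) * (Real.exp (-(a * t)) / a)
          = Real.exp (-(a * (t - τ))) := by
        rw [show -(a * (t - τ)) = a * τ + -(a * t) by ring, Real.exp_add, hC]; ring
      rw [s4] at s3
      have s5 : Real.exp (-(a * (t - τ))) ≤ 1 := by
        rw [Real.exp_le_one_iff]; nlinarith
      have := pow_le_pow_left₀ (by linarith) s3 n
      linarith

lemma mvt_aux (r r' : ℝ → ℝ) (B s : ℝ) (hr : ∀ x, HasDerivAt r (r' x) x) (h0 : r 0 = 0)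
    (hB : ∀ x, |x| ≤ |s| → |r' x| ≤ B) : |r s| ≤ B * |s| := by
  have := Convex.norm_image_sub_le_of_norm_hasDerivWithin_le (f := r) (f' := r') (C := B)
    (s := Set.Icc (-|s|) |s|) (x := 0) (y := s) (fun x _ => (hr x).hasDerivWithinAt)
    (fun x hx => hB x (abs_le.2 hx)) (convex_Icc _ _) (by simp) (abs_le.1 le_rfl)
  simpa [h0] using this

lemma taylor3 (f f1 f2 f3 : ℝ → ℝ) (L : ℝ) (h1 : ∀ x, HasDerivAt f (f1 x) x)
    (h2 : ∀ x, HasDerivAt f1 (f2 x) x) (h3 : ∀ x, HasDerivAt f2 (f3 x) x)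
    (hL : ∀ x, |f3 x| ≤ L) (s : ℝ) :
    |f s - (f 0 + f1 0 * s + f2 0 / 2 * s^2)| ≤ L * |s|^3 := by
  have hL0 : 0 ≤ L := (abs_nonneg _).trans (hL 0)
  have a2 : ∀ x, |f2 x - f2 0| ≤ L * |x| := fun x =>
    mvt_aux (fun x => f2 x - f2 0) f3 L x (fun x => (h3 x).sub_const _) (by simp) (fun x _ => hL x)
  have a1 : ∀ x, |f1 x - (f1 0 + f2 0 * x)| ≤ L * |x| * |x| := fun x =>
    mvt_aux (fun x => f1 x - (f1 0 + f2 0 * x)) (fun x => f2 x - f2 0) (L * |x|) x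
      (fun x => by
        have := (h2 x).sub (((hasDerivAt_id x).const_mul (f2 0)).const_add (f1 0))
        exact this.congr_deriv (by simp)) (by simp)
      (fun y hy => (a2 y).trans (by gcongr))
  have a0 := mvt_aux (fun x => f x - (f 0 + f1 0 * x + f2 0 / 2 * x^2))
      (fun x => f1 x - (f1 0 + f2 0 * x)) (L * |s| * |s|) s
      (fun x => by
        have := (h1 x).sub ((((hasDerivAt_id x).const_mul (f1 0)).const_add (f 0)).add
          (((hasDerivAt_id x).pow 2).const_mul (f2 0 / 2)))
        refine this.congr_deriv ?_
        simp; ring) (by simp)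
      (fun y hy => (a1 y).trans (by gcongr))
  calc _ ≤ L * |s| * |s| * |s| := a0
    _ = _ := by ring

lemma lse_taylor {ι : Type} [Fintype ι] [Nonempty ι] (w c : ι → ℝ) (δ : ℝ) (hw : ∀ k, 0 < w k)
    (hc : ∀ k, |c k| ≤ δ) : ∃ A B D : ℝ, ∀ s : ℝ,
    |Real.log (∑ k, w k * Real.exp (c k * s)) - (A + B * s + D * s^2)| ≤ (6 * δ^3) * |s|^3 := by
  obtain ⟨k0⟩ := ‹Nonempty ι›
  have hδ : 0 ≤ δ := (abs_nonneg _).trans (hc k0)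
  have : Nonempty ι := ⟨k0⟩
  set S : ℕ → ℝ → ℝ := fun j s => ∑ k, w k * c k ^ j * Real.exp (c k * s) with hS
  have hSd : ∀ j s, HasDerivAt (S j) (S (j+1) s) s := by
    intro j s
    apply HasDerivAt.fun_sum
    intro k _
    have := (((hasDerivAt_id s).const_mul (c k)).exp.const_mul (w k * c k ^ j))
    refine this.congr_deriv ?_
    simp; ring
  have hS0 : ∀ s, 0 < S 0 s := fun s => Finset.sum_pos (fun k _ => by
    have := hw k; positivity) Finset.univ_nonempty
  have hSb : ∀ j s, |S j s / S 0 s| ≤ δ ^ j := by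
    intro j s
    rw [abs_div, abs_of_pos (hS0 s), div_le_iff₀ (hS0 s)]
    calc |S j s| ≤ ∑ k, |w k * c k ^ j * Real.exp (c k * s)| := Finset.abs_sum_le_sum_abs _ _
      _ ≤ ∑ k, δ^j * (w k * c k ^ 0 * Real.exp (c k * s)) := by
        apply Finset.sum_le_sum
        intro k _
        rw [abs_mul, abs_mul, abs_of_pos (hw k), abs_of_pos (Real.exp_pos _), abs_pow]
        have := pow_le_pow_left₀ (abs_nonneg _) (hc k) j
        have h2 : 0 ≤ w k * Real.exp (c k * s) := by have := hw k; positivity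
        nlinarith
      _ = _ := by rw [← Finset.mul_sum]
  set R : ℕ → ℝ → ℝ := fun j s => S j s / S 0 s with hR
  have hRd : ∀ j s, HasDerivAt (R j) (R (j+1) s - R j s * R 1 s) s := by
    intro j s
    have := (hSd j s).div (hSd 0 s) (hS0 s).ne'
    refine this.congr_deriv ?_
    have := (hS0 s).ne'
    simp only [hR]
    field_simp
  refine ⟨Real.log (S 0 0), R 1 0, (R 2 0 - R 1 0 * R 1 0) / 2, fun s => ?_⟩
  have e : ∀ s, ∑ k, w k * Real.exp (c k * s) = S 0 s := fun s => by simp [hS]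
  rw [e]
  refine taylor3 (fun s => Real.log (S 0 s)) (R 1) (fun s => R 2 s - R 1 s * R 1 s)
    (fun s => (R 3 s - R 2 s * R 1 s) - ((R 2 s - R 1 s * R 1 s) * R 1 s + R 1 s * (R 2 s - R 1 s * R 1 s)))
    (6 * δ^3) ?_ ?_ ?_ ?_ s
  · intro x
    exact (hSd 0 x).log (hS0 x).ne'
  · intro x; exact hRd 1 x
  · intro x; exact (hRd 2 x).sub ((hRd 1 x).mul (hRd 1 x))
  · intro x
    have b1 : |R 1 x| ≤ δ := by simpa using hSb 1 x
    have b2 : |R 2 x| ≤ δ^2 := hSb 2 x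
    have b3 : |R 3 x| ≤ δ^3 := hSb 3 x
    have b21 : |R 2 x * R 1 x| ≤ δ^2 * δ := by rw [abs_mul]; gcongr
    have b111 : |R 1 x * R 1 x * R 1 x| ≤ δ * δ * δ := by rw [abs_mul, abs_mul]; gcongr
    rw [abs_le] at *
    constructor <;> nlinarith

/-- `1 + E|g|^3`. -/
def C3 : ℝ := 1 + ∫ x, |x|^3 ∂(ProbabilityTheory.gaussianReal 0 1)

open MeasureTheory ProbabilityTheory in
lemma lind_one (Ψ : ℝ → ℝ) (A B D L : ℝ) (hΨ : Integrable Ψ (gaussianReal 0 1))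
    (h : ∀ s, |Ψ s - (A + B * s + D * s^2)| ≤ L * |s|^3) :
    (Ψ 1 + Ψ (-1)) / 2 ≤ ∫ s, Ψ s ∂(gaussianReal 0 1) + L * C3 := by
  have i1 : Integrable (fun x : ℝ => x) (gaussianReal 0 1) :=
    (memLp_id_gaussianReal (μ := 0) (v := 1) 1).integrable (by simp)
  have i2 : Integrable (fun x : ℝ => x^2) (gaussianReal 0 1) :=
    (memLp_id_gaussianReal (μ := 0) (v := 1) 2).integrable_sq
  have i3 : Integrable (fun x : ℝ => |x|^3) (gaussianReal 0 1) := by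
    have := (memLp_id_gaussianReal (μ := 0) (v := 1) 3).integrable_norm_pow (by simp)
    simpa using this
  have m1 : ∫ x, x ∂(gaussianReal 0 1) = 0 := by simp
  have m2 : ∫ x, x^2 ∂(gaussianReal 0 1) = 1 := by
    have h1 := variance_id_gaussianReal (μ := 0) (v := 1)
    rw [variance_eq_integral (by fun_prop)] at h1
    simpa using h1
  have k : ∫ s, (A + B * s + D * s^2 - L * |s|^3) ∂(gaussianReal 0 1) ≤ ∫ s, Ψ s ∂(gaussianReal 0 1) := by
    apply integral_mono _ hΨ
    · intro s
      have := abs_le.1 (h s)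
      simp only; linarith
    · exact ((((integrable_const A).add (i1.const_mul B)).add (i2.const_mul D)).sub (i3.const_mul L))
  have k2 : ∫ s, (A + B * s + D * s^2 - L * |s|^3) ∂(gaussianReal 0 1)
      = A + D - L * ∫ x, |x|^3 ∂(gaussianReal 0 1) := by
    have j1 : Integrable (fun s : ℝ => A + B * s) (gaussianReal 0 1) :=
      (integrable_const A).add (i1.const_mul B)
    have j2 : Integrable (fun s : ℝ => A + B * s + D * s^2) (gaussianReal 0 1) :=
      j1.add (i2.const_mul D)
    rw [integral_sub j2 (i3.const_mul L), integral_add j1 (i2.const_mul D),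
      integral_add (integrable_const A) (i1.const_mul B), integral_const_mul, integral_const_mul,
      integral_const_mul, m1, m2]
    simp
  have e1 := abs_le.1 (h 1)
  have e2 := abs_le.1 (h (-1))
  simp at e1 e2
  unfold C3
  nlinarith

/-- log-sum-exp. -/
def lse {ι : Type} [Fintype ι] {m : ℕ} (w : ι → ℝ) (c : ι → Fin m → ℝ) (x : Fin m → ℝ) : ℝ :=
  Real.log (∑ k, w k * Real.exp (∑ j, c k j * x j))

open MeasureTheory ProbabilityTheory in
lemma lse_int {ι : Type} [Fintype ι] [Nonempty ι] {m : ℕ} (w : ι → ℝ) (c : ι → Fin m → ℝ) (δ : ℝ)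
    (hw : ∀ k, 0 < w k) (hc : ∀ k j, |c k j| ≤ δ) : Integrable (lse w c) (gam m) := by
  have hpos : ∀ x : Fin m → ℝ, 0 < ∑ k, w k * Real.exp (∑ j, c k j * x j) := fun x =>
    Finset.sum_pos (fun k _ => by have := hw k; positivity) Finset.univ_nonempty
  have hcont : Continuous (lse w c) := by
    unfold lse
    apply Continuous.log (by fun_prop) (fun x => (hpos x).ne')
  have hW : 0 < ∑ k, w k := Finset.sum_pos (fun k _ => hw k) Finset.univ_nonempty
  have hB : Integrable (fun x : Fin m → ℝ => |Real.log (∑ k, w k)| + ∑ j, δ * |x j|) (gam m) :=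
    (integrable_const _).add (integrable_finsetSum _ fun j _ => (gam_abs_int m j).const_mul _)
  apply hB.mono' hcont.aestronglyMeasurable
  refine .of_forall fun x => ?_
  have hb : ∀ k, |∑ j, c k j * x j| ≤ ∑ j, δ * |x j| := fun k =>
    (Finset.abs_sum_le_sum_abs _ _).trans (Finset.sum_le_sum fun j _ => by
      rw [abs_mul]; gcongr; exact hc k j)
  set T := ∑ j, δ * |x j|
  have up : lse w c x ≤ Real.log (∑ k, w k) + T := by
    unfold lse
    rw [← Real.log_exp T, ← Real.log_mul hW.ne' (Real.exp_pos _).ne']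
    apply Real.log_le_log (hpos x)
    rw [Finset.sum_mul]
    apply Finset.sum_le_sum
    intro k _
    have := hw k
    gcongr
    exact (abs_le.1 (hb k)).2
  have lo : Real.log (∑ k, w k) - T ≤ lse w c x := by
    unfold lse
    rw [sub_eq_add_neg, ← Real.log_exp (-T), ← Real.log_mul hW.ne' (Real.exp_pos _).ne']
    apply Real.log_le_log (by positivity)
    rw [Finset.sum_mul]
    apply Finset.sum_le_sum
    intro k _
    have := hw k
    gcongr
    exact (abs_le.1 (hb k)).1
  rw [Real.norm_eq_abs, abs_le]
  constructor
  · linarith [neg_abs_le (Real.log (∑ k, w k))]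
  · linarith [le_abs_self (Real.log (∑ k, w k))]

lemma lse_cons {ι : Type} [Fintype ι] {m : ℕ} (w : ι → ℝ) (c : ι → Fin (m+1) → ℝ)
    (s : ℝ) (y : Fin m → ℝ) : lse w c (Fin.cons s y : Fin (m+1) → ℝ) =
      lse (fun k => w k * Real.exp (c k 0 * s)) (fun k j => c k j.succ) y := by
  unfold lse
  congr 1
  apply Finset.sum_congr rfl
  intro k _
  rw [Fin.sum_univ_succ, Real.exp_add]
  simp [mul_assoc]

lemma lse_cons' {ι : Type} [Fintype ι] {m : ℕ} (w : ι → ℝ) (c : ι → Fin (m+1) → ℝ)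
    (s : ℝ) (y : Fin m → ℝ) : lse w c (Fin.cons s y : Fin (m+1) → ℝ) =
      Real.log (∑ k, (w k * Real.exp (∑ j : Fin m, c k j.succ * y j)) * Real.exp (c k 0 * s)) := by
  unfold lse
  congr 1
  apply Finset.sum_congr rfl
  intro k _
  rw [Fin.sum_univ_succ, Real.exp_add]
  simp; ring

open MeasureTheory ProbabilityTheory in
lemma lind {ι : Type} [Fintype ι] [Nonempty ι] (δ : ℝ) (m : ℕ) : ∀ (w : ι → ℝ) (c : ι → Fin m → ℝ)
    (_ : ∀ k, 0 < w k) (_ : ∀ k j, |c k j| ≤ δ),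
    (2^m : ℝ)⁻¹ * ∑ ε : Fin m → Bool, lse w c (fun i => sgn (ε i)) ≤
      ∫ x, lse w c x ∂(gam m) + m * (6 * δ^3 * C3) := by
  induction m with
  | zero =>
    intro w c hw hc
    have e : ∀ x : Fin 0 → ℝ, lse w c x = lse w c 0 := fun x => by rw [Subsingleton.elim x 0]
    simp [e]
  | succ m ih =>
    intro w c hw hc
    have hw' : ∀ s k, 0 < w k * Real.exp (c k 0 * s) := fun s k => by have := hw k; positivity
    have i1 := ih (fun k => w k * Real.exp (c k 0 * 1)) (fun k j => c k j.succ) (hw' 1) (fun k j => hc k _)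
    have i2 := ih (fun k => w k * Real.exp (c k 0 * (-1))) (fun k j => c k j.succ) (hw' (-1)) (fun k j => hc k _)
    have hsum : ∑ ε : Fin (m+1) → Bool, lse w c (fun i => sgn (ε i)) =
        ∑ ε : Fin m → Bool, lse (fun k => w k * Real.exp (c k 0 * 1)) (fun k j => c k j.succ) (fun i => sgn (ε i))
        + ∑ ε : Fin m → Bool, lse (fun k => w k * Real.exp (c k 0 * (-1))) (fun k j => c k j.succ) (fun i => sgn (ε i)) := by
      rw [← (Fin.consEquiv (fun _ : Fin (m+1) => Bool)).sum_comp, Fintype.sum_prod_type]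
      have e : ∀ (b : Bool) (ε : Fin m → Bool), (fun i => sgn ((Fin.consEquiv (fun _ : Fin (m+1) => Bool)) (b, ε) i))
          = (Fin.cons (sgn b) (fun i => sgn (ε i)) : Fin (m+1) → ℝ) := by
        intro b ε
        ext i
        refine Fin.cases ?_ (fun j => ?_) i <;> simp [Fin.consEquiv]
      simp only [e, lse_cons]
      simp [sgn]
    have int1 := lse_int (fun k => w k * Real.exp (c k 0 * 1)) (fun k j => c k j.succ) δ (hw' 1) (fun k (j : Fin m) => hc k _)
    have int2 := lse_int (fun k => w k * Real.exp (c k 0 * (-1))) (fun k j => c k j.succ) δ (hw' (-1)) (fun k (j : Fin m) => hc k _)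
    have intp : Integrable (fun p : ℝ × (Fin m → ℝ) => lse w c (Fin.cons p.1 p.2 : Fin (m+1) → ℝ))
        ((gaussianReal 0 1).prod (gam m)) :=
      (gam_mp m).integrable_comp_of_integrable (lse_int w c δ hw hc)
    have hfub : ∫ x, lse w c x ∂(gam (m+1)) =
        ∫ y, ∫ s, lse w c (Fin.cons s y : Fin (m+1) → ℝ) ∂(gaussianReal 0 1) ∂(gam m) := by
      rw [← integral_prod_symm _ intp, ← (gam_mp m).map_eq, integral_map (gam_mp m).measurable.aemeasurable]
      rw [(gam_mp m).map_eq]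
      exact (lse_int w c δ hw hc).aestronglyMeasurable
    have hstep : ∫ y, (lse w c (Fin.cons 1 y : Fin (m+1) → ℝ) + lse w c (Fin.cons (-1) y : Fin (m+1) → ℝ)) / 2 ∂(gam m)
        ≤ ∫ y, (∫ s, lse w c (Fin.cons s y : Fin (m+1) → ℝ) ∂(gaussianReal 0 1) + 6 * δ^3 * C3) ∂(gam m) := by
      have hae := intp.prod_left_ae
      apply integral_mono_ae
      · simp only [lse_cons]
        exact (int1.add int2).div_const 2
      · exact intp.integral_prod_right.add (integrable_const _)
      · filter_upwards [hae] with y hy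
        obtain ⟨A, B, D, hT⟩ := lse_taylor (fun k => w k * Real.exp (∑ j : Fin m, c k j.succ * y j))
          (fun k => c k 0) δ (fun k => by have := hw k; positivity) (fun k => hc k 0)
        apply lind_one _ A B D _ hy
        intro s
        rw [lse_cons']
        exact hT s
    rw [integral_add intp.integral_prod_right (integrable_const _), ← hfub] at hstep
    simp only [lse_cons] at hstep
    rw [integral_div, integral_add int1 int2] at hstep
    simp only [integral_const, probReal_univ, one_smul] at hstep
    rw [hsum, pow_succ, mul_inv]
    push_cast
    linarith

open MeasureTheory ProbabilityTheory in
lemma beta_bound {n : ℕ} (hn : 0 < n) (U : Matrix (Fin n) (Fin n) ℝ) (hU : ∀ k, ∑ i, U k i ^ 2 = 1)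
    (d : ℝ) (hd : ∀ i j, |U i j| ≤ d) (r : ℝ) (hr : 0 < r)
    (a τ : ℝ) (ha : 0 < a) (hτ : 0 ≤ τ)
    (hC : Real.exp (a * τ) = 2 * (Real.sqrt (2 * Real.pi))⁻¹ * Real.exp (a^2/2) / a) :
    badBeta U ≤ τ + (harmonic n : ℝ) / a + Real.log (2 * n) / r + n * (6 * (r^2 * d^3) * C3) := by
  have : Nonempty (Fin n) := ⟨⟨0, hn⟩⟩
  set c : Fin n × Bool → Fin n → ℝ := fun k j => r * sgn k.2 * U k.1 j with hc
  have habs : ∀ b, |sgn b| = 1 := by intro b; cases b <;> simp [sgn]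
  have hcb : ∀ k j, |c k j| ≤ r * d := by
    intro k j
    simp only [hc]
    rw [abs_mul, abs_mul, habs, abs_of_pos hr, mul_one]
    gcongr
    exact hd _ _
  have hL := lind (ι := Fin n × Bool) (r * d) n (fun _ => 1) c (fun _ => one_pos) hcb
  have hdot : ∀ k x, ∑ j, c k j * x j = r * (sgn k.2 * U.mulVec x k.1) := by
    intro k x
    simp only [hc, Matrix.mulVec, dotProduct, Finset.mul_sum]
    apply Finset.sum_congr rfl; intro j _; ring
  have lo : ∀ x, r * ‖U.mulVec x‖ ≤ lse (fun _ => 1) c x := by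
    intro x
    rw [mul_comm, ← le_div_iff₀ hr]
    rw [pi_norm_le_iff_of_nonempty]
    intro i
    rw [le_div_iff₀ hr]
    obtain ⟨b, hb⟩ : ∃ b : Bool, ‖U.mulVec x i‖ = sgn b * U.mulVec x i := by
      rcases le_total 0 (U.mulVec x i) with h | h
      · exact ⟨true, by simp [sgn, abs_of_nonneg h]⟩
      · exact ⟨false, by simp [sgn, abs_of_nonpos h]⟩
    unfold lse
    rw [Real.le_log_iff_exp_le (Finset.sum_pos (fun k _ => by positivity) Finset.univ_nonempty)]
    refine le_trans ?_ (Finset.single_le_sum (f := fun k => (1:ℝ) * Real.exp (∑ j, c k j * x j))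
      (fun k _ => by positivity) (Finset.mem_univ (i, b)))
    rw [hdot, hb, one_mul, mul_comm]
  have up : ∀ x, lse (fun _ => 1) c x ≤ r * ‖U.mulVec x‖ + Real.log (2 * n) := by
    intro x
    have h2n : (0:ℝ) < 2 * n := by positivity
    unfold lse
    rw [← Real.log_exp (r * ‖U.mulVec x‖), ← Real.log_mul (Real.exp_pos _).ne' h2n.ne']
    apply Real.log_le_log (Finset.sum_pos (fun k _ => by positivity) Finset.univ_nonempty)
    calc ∑ k, 1 * Real.exp (∑ j, c k j * x j) ≤ ∑ k : Fin n × Bool, Real.exp (r * ‖U.mulVec x‖) := by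
          apply Finset.sum_le_sum
          intro k _
          rw [one_mul, hdot]
          gcongr
          calc sgn k.2 * U.mulVec x k.1 ≤ |sgn k.2 * U.mulVec x k.1| := le_abs_self _
            _ = ‖U.mulVec x k.1‖ := by rw [abs_mul, habs, one_mul]; rfl
            _ ≤ _ := norm_le_pi_norm _ _
      _ = _ := by simp; ring
  obtain ⟨e1, e2⟩ := emax U hU a τ ha hτ hC
  have g1 : ∫ x, lse (fun _ => 1) c x ∂(gam n) ≤ r * ∫ x, ‖U.mulVec x‖ ∂(gam n) + Real.log (2 * n) := by
    calc _ ≤ ∫ x, (r * ‖U.mulVec x‖ + Real.log (2 * n)) ∂(gam n) :=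
          integral_mono (lse_int _ _ (r * d) (fun _ => one_pos) hcb)
            ((e1.const_mul r).add (integrable_const _)) up
      _ = _ := by
        rw [integral_add (e1.const_mul r) (integrable_const _), integral_const_mul]
        simp
  have hinj : Function.Injective (fun (ε : Fin n → Bool) i => sgn (ε i)) := by
    intro x y hxy
    ext i
    have := congrFun hxy i
    cases hx : x i <;> cases hy : y i <;> simp [sgn, hx, hy] at this ⊢ <;> linarith
  have hb : r * badBeta U ≤ (2^n : ℝ)⁻¹ * ∑ ε : Fin n → Bool, lse (fun _ => 1) c (fun i => sgn (ε i)) := by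
    unfold badBeta cube
    rw [Finset.sum_image (fun x _ y _ h => hinj h), mul_left_comm, Finset.mul_sum]
    gcongr
    exact lo _
  have fin : r * badBeta U ≤ r * (τ + (harmonic n : ℝ) / a + Real.log (2 * n) / r + n * (6 * (r^2 * d^3) * C3)) := by
    have : r * (τ + (harmonic n : ℝ) / a + Real.log (2 * n) / r + n * (6 * (r^2 * d^3) * C3))
      = r * (τ + (harmonic n : ℝ) / a) + Real.log (2 * n) + n * (6 * (r * d)^3 * C3) := by
      field_simp
    rw [this]
    have := mul_le_mul_of_nonneg_left e2 hr.le
    linarith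
  exact le_of_mul_le_mul_left fin hr

open Filter Topology in
lemma log_pow_sqrt : Tendsto (fun n : ℕ => Real.log (2 * n) ^ 5 / Real.sqrt n) atTop (𝓝 0) := by
  have h1 : Tendsto (fun x : ℝ => Real.log x ^ 10 / x) atTop (𝓝 0) := by
    have := (Real.isLittleO_pow_log_id_atTop (n := 10)).tendsto_div_nhds_zero
    simpa using this
  have h2 : Tendsto (fun n : ℕ => 2 * (n : ℝ)) atTop atTop :=
    tendsto_natCast_atTop_atTop.const_mul_atTop two_pos
  have h3 := ((h1.comp h2).const_mul 2).sqrt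
  simp only [mul_zero, Real.sqrt_zero] at h3
  refine h3.congr' ?_
  filter_upwards [eventually_ge_atTop 1] with n hn
  have hn' : (1:ℝ) ≤ n := by exact_mod_cast hn
  have hl : 0 ≤ Real.log (2 * n) := Real.log_nonneg (by linarith)
  simp only [Function.comp]
  rw [show 2 * (Real.log (2 * n) ^ 10 / (2 * n)) = (Real.log (2 * n) ^ 5)^2 / n by field_simp,
    Real.sqrt_div (by positivity), Real.sqrt_sq (by positivity)]

open Filter in
lemma limsup_le_zero_of (u : ℕ → ℝ) (h : ∀ e > 0, ∀ᶠ n in atTop, u n ≤ e) :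
    limsup u atTop ≤ 0 := by
  rw [limsup_eq]
  by_cases hb : BddBelow {a | ∀ᶠ n in atTop, u n ≤ a}
  · apply le_of_forall_pos_le_add
    intro e he
    rw [zero_add]
    exact csInf_le hb (h e he)
  · rw [Real.sInf_of_not_bddBelow hb]

lemma main_bound (M : ℝ) (hM : 0 < M) (n : ℕ) (hn : 3 ≤ n) (A : Matrix (Fin n) (Fin n) ℝ)
    (hrow : ∀ i, ∑ j, (A i j) ^ 2 = (n : ℝ)) (hbd : ∀ i j, |A i j| ≤ M) :
    Real.sqrt (Real.log n) *
        (badBeta ((Real.sqrt n)⁻¹ • A) -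
          (Real.sqrt (2 * Real.log (2 * n)) -
            (Real.log (Real.log (2 * n)) + Real.log (4 * Real.pi) -
                2 * Real.eulerMascheroniConstant) /
              (2 * Real.sqrt (2 * Real.log (2 * n))))) ≤
      |(harmonic n : ℝ) - Real.log n - Real.eulerMascheroniConstant|
        + (Real.sqrt (Real.log (2 * n)))⁻¹ + 6 * M^3 * C3 * (Real.log (2 * n) ^ 5 / Real.sqrt n) := by
  have hn' : (3:ℝ) ≤ n := by exact_mod_cast hn
  have hn0 : (0:ℝ) < n := by linarith
  have hsn : 0 < Real.sqrt n := Real.sqrt_pos.2 hn0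
  have hsq : Real.sqrt n ^ 2 = n := Real.sq_sqrt hn0.le
  set l := Real.log (2 * n) with hl
  have hl1 : 1 ≤ l := by
    rw [hl, Real.le_log_iff_exp_le (by linarith)]
    linarith [Real.exp_one_lt_d9]
  have hl0 : 0 < l := by linarith
  have hlog : l = Real.log 2 + Real.log n := by rw [hl, Real.log_mul (by norm_num) hn0.ne']
  have hlogn : 0 ≤ Real.log n := Real.log_nonneg (by linarith)
  have hlogn' : Real.log n ≤ l := by have := Real.log_pos (show (1:ℝ) < 2 by norm_num); linarith
  set a := Real.sqrt (2 * l) with ha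
  have ha0 : 0 < a := Real.sqrt_pos.2 (by linarith)
  have ha2 : a^2 = 2 * l := Real.sq_sqrt (by linarith)
  have hla : Real.log a = (Real.log 2 + Real.log l) / 2 := by
    rw [ha, Real.log_sqrt (by linarith), Real.log_mul (by norm_num) hl0.ne']
  set Q := 2 * (Real.sqrt (2 * Real.pi))⁻¹ * Real.exp (a^2/2) / a with hQ
  have hpi := Real.pi_pos
  have hQ0 : 0 < Q := by positivity
  have hexp : Real.exp (a^2/2) = 2 * n := by
    rw [ha2, mul_div_cancel_left₀ _ two_ne_zero, hl, Real.exp_log (by linarith)]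
  have hQ1 : 1 ≤ Q := by
    rw [hQ, hexp, le_div_iff₀ ha0, one_mul, mul_comm 2 _, mul_assoc, inv_mul_eq_div,
      le_div_iff₀ (by positivity), ha, ← Real.sqrt_mul (by linarith)]
    apply Real.sqrt_le_iff.2 ⟨by linarith, ?_⟩
    have h1 : l ≤ 2 * n := (Real.log_le_sub_one_of_pos (by linarith)).trans (by linarith)
    have h2 : l * Real.pi ≤ 2 * n * 4 := by
      apply mul_le_mul h1 Real.pi_le_four hpi.le (by linarith)
    nlinarith
  have hlQ : Real.log Q = Real.log 2 - (Real.log 2 + Real.log Real.pi) / 2 + l - Real.log a := by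
    rw [hQ, hexp, Real.log_div (by positivity) ha0.ne', Real.log_mul (by positivity) (by positivity),
      Real.log_mul (by positivity) (by positivity), Real.log_inv, Real.log_sqrt (by positivity),
      Real.log_mul (by norm_num) hpi.ne', ← hl]
    ring
  have hlogQ : 0 ≤ Real.log Q := Real.log_nonneg hQ1
  have hU : ∀ k, ∑ i, ((Real.sqrt n)⁻¹ • A) k i ^ 2 = 1 := by
    intro k
    simp only [Matrix.smul_apply, smul_eq_mul, mul_pow]
    rw [← Finset.mul_sum, hrow, inv_pow, hsq]
    field_simp
  have hd : ∀ i j, |((Real.sqrt n)⁻¹ • A) i j| ≤ M / Real.sqrt n := by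
    intro i j
    simp only [Matrix.smul_apply, smul_eq_mul]
    rw [abs_mul, abs_of_pos (inv_pos.2 hsn), inv_mul_eq_div]
    gcongr
    exact hbd i j
  have hB := beta_bound (by omega) ((Real.sqrt n)⁻¹ • A) hU (M / Real.sqrt n) hd (l^2) (by positivity)
    a (Real.log Q / a) ha0 (by positivity) (by rw [mul_div_cancel₀ _ ha0.ne', Real.exp_log hQ0])
  set γ := Real.eulerMascheroniConstant
  set H := (harmonic n : ℝ)
  have hl4 : Real.log (4 * Real.pi) = 2 * Real.log 2 + Real.log Real.pi := by
    rw [Real.log_mul (by norm_num) hpi.ne', show (4:ℝ) = 2^2 by norm_num, Real.log_pow]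
    norm_num
  have key : Real.log Q / a + H / a = a - (Real.log l + Real.log (4 * Real.pi) - 2 * γ) / (2 * a)
      + (H - Real.log n - γ) / a := by
    rw [hlQ, hla, hl4]
    field_simp
    rw [ha2, hlog]
    ring
  have hthird : n * (6 * ((l^2)^2 * (M / Real.sqrt n)^3) * C3) = 6 * M^3 * C3 * (l^4 / Real.sqrt n) := by
    have : (n:ℝ) * (M / Real.sqrt n)^3 = M^3 / Real.sqrt n := by
      conv_lhs => rw [← hsq]
      rw [Real.sqrt_sq hsn.le]
      field_simp
    calc _ = 6 * ((n:ℝ) * (M / Real.sqrt n)^3) * C3 * l^4 := by ring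
      _ = _ := by rw [this]; ring
  have hC3 : 0 ≤ C3 := by
    unfold C3
    have : 0 ≤ ∫ x, |x|^3 ∂(ProbabilityTheory.gaussianReal 0 1) :=
      MeasureTheory.integral_nonneg fun x => by positivity
    linarith
  have hB2 : badBeta ((Real.sqrt n)⁻¹ • A) - (a - (Real.log l + Real.log (4 * Real.pi) - 2 * γ) / (2 * a))
      ≤ |H - Real.log n - γ| / a + l / l^2 + 6 * M^3 * C3 * (l^4 / Real.sqrt n) := by
    have : (H - Real.log n - γ) / a ≤ |H - Real.log n - γ| / a := by
      gcongr; exact le_abs_self _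
    linarith
  have sl : Real.sqrt (Real.log n) ≤ Real.sqrt l := Real.sqrt_le_sqrt hlogn'
  have sla : Real.sqrt l ≤ a := Real.sqrt_le_sqrt (by linarith)
  have sll : Real.sqrt l ≤ l := by
    rw [Real.sqrt_le_iff]; constructor <;> nlinarith
  have hsl0 : 0 < Real.sqrt l := Real.sqrt_pos.2 hl0
  calc _ ≤ Real.sqrt (Real.log n) * (|H - Real.log n - γ| / a + l / l^2 + 6 * M^3 * C3 * (l^4 / Real.sqrt n)) :=
        mul_le_mul_of_nonneg_left hB2 (Real.sqrt_nonneg _)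
    _ ≤ Real.sqrt l * (|H - Real.log n - γ| / a + l / l^2 + 6 * M^3 * C3 * (l^4 / Real.sqrt n)) := by
        gcongr
    _ = (Real.sqrt l / a) * |H - Real.log n - γ| + Real.sqrt l / l + 6 * M^3 * C3 * (Real.sqrt l * l^4 / Real.sqrt n) := by
        field_simp
    _ ≤ 1 * |H - Real.log n - γ| + (Real.sqrt l)⁻¹ + 6 * M^3 * C3 * (l * l^4 / Real.sqrt n) := by
        gcongr
        · rw [div_le_one ha0]; exact sla
        · rw [Real.sqrt_div_self']; simp
    _ = _ := by ring

theorem stmt16 (M a b : ℝ) (hM : 0 < M) (ha : 0 < a) (hb : 0 < b)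
    (A : (n : ℕ) → Matrix (Fin n) (Fin n) ℝ)
    (hrow : ∀ n : ℕ, 3 ≤ n → ∀ i, ∑ j, (A n i j) ^ 2 = (n : ℝ))
    (hbd : ∀ n : ℕ, 3 ≤ n → ∀ i j, |A n i j| ≤ M)
    (hdet2 : ∀ n : ℕ, 3 ≤ n → ∀ j k : Fin n, j ≠ k →
      a ^ 2 <
        ((((n : ℝ)⁻¹ • (A n * (A n).transpose)).submatrix ![j, k] ![j, k]).det))
    (hdet3 : ∀ n : ℕ, 3 ≤ n → ∀ j k l : Fin n, j ≠ k → j ≠ l → k ≠ l →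
      b ^ 2 <
        ((((n : ℝ)⁻¹ • (A n * (A n).transpose)).submatrix ![j, k, l] ![j, k, l]).det) /
          ((((n : ℝ)⁻¹ • (A n * (A n).transpose)).submatrix ![j, k] ![j, k]).det)) :
    Filter.limsup (fun n : ℕ => Real.sqrt (Real.log n) *
        (badBeta ((Real.sqrt n)⁻¹ • A n) -
          (Real.sqrt (2 * Real.log (2 * n)) -
            (Real.log (Real.log (2 * n)) + Real.log (4 * Real.pi) -
                2 * Real.eulerMascheroniConstant) /
              (2 * Real.sqrt (2 * Real.log (2 * n))))))
      Filter.atTop ≤ 0 := by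
  apply limsup_le_zero_of
  intro e he
  have t1 : Filter.Tendsto (fun n : ℕ => |(harmonic n : ℝ) - Real.log n - Real.eulerMascheroniConstant|)
      Filter.atTop (nhds 0) := by
    have := (Real.tendsto_harmonic_sub_log.sub_const Real.eulerMascheroniConstant).abs
    simpa using this
  have h2 : Filter.Tendsto (fun n : ℕ => 2 * (n : ℝ)) Filter.atTop Filter.atTop :=
    tendsto_natCast_atTop_atTop.const_mul_atTop two_pos
  have t2 : Filter.Tendsto (fun n : ℕ => (Real.sqrt (Real.log (2 * n)))⁻¹)
      Filter.atTop (nhds 0) :=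
    Filter.Tendsto.inv_tendsto_atTop
      (Real.tendsto_sqrt_atTop.comp (Real.tendsto_log_atTop.comp h2))
  have t3 := log_pow_sqrt.const_mul (6 * M^3 * C3)
  have t := (t1.add t2).add t3
  simp only [mul_zero, add_zero] at t
  filter_upwards [t.eventually (gt_mem_nhds he), Filter.eventually_ge_atTop 3] with n hn hn3
  exact (main_bound M hM n hn3 (A n) (hrow n hn3) (hbd n hn3)).trans hn.le
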